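/- Let m ≥ 2, n_1,…,n_m ≥ 1, r ≥ 1 a natural number, and α ≠ 0 a real number. Then α is an eigenvalue of the adjacency matrix of K^m_{n_1,n_2,…,n_m} if and only if r^{m−1}·α is an eigenvalue of the adjacency matrix of K^m_{rn_1,rn_2,…,rn_m}. -/

import Mathlib

open scoped BigOperators
open Polynomial

/-- The edge set of the complete `m`-uniform `m`-partite hypergraph with parts
`V_p = {p} × Fin (nn p)`: all `m`-element subsets containing exactly one vertex
from each part. -/
def KEdges (m : ℕ) (nn : Fin m → ℕ) : Finset (Finset (Σ p : Fin m, Fin (nn p))) :=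
  Finset.univ.filter
    (fun f => f.card = m ∧ ∀ p : Fin m, (f.filter (fun x => x.1 = p)).card = 1)

/-- The adjacency matrix: `A i j = d_{ij} / (m - 1)` for `i ≠ j`, where `d_{ij}`
is the number of edges containing both `i` and `j`, and `A i i = 0`. -/
noncomputable def KAdj (m : ℕ) (nn : Fin m → ℕ) :
    Matrix (Σ p : Fin m, Fin (nn p)) (Σ p : Fin m, Fin (nn p)) ℝ :=
  fun i j => if i = j then 0 else
    (((KEdges m nn).filter (fun f => i ∈ f ∧ j ∈ f)).card : ℝ) / ((m : ℝ) - 1)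

lemma mem_KEdges_iff {m : ℕ} {nn : Fin m → ℕ} {e : Finset (Σ p : Fin m, Fin (nn p))} :
    e ∈ KEdges m nn ↔ ∃ f : ∀ p, Fin (nn p), Finset.univ.filter (fun x => f x.1 = x.2) = e := by
  have filter_eq (f : ∀ p, Fin (nn p)) (p : Fin m) :
      (Finset.univ.filter (fun x : Σ p, Fin (nn p) => f x.1 = x.2)).filter (fun x => x.1 = p)
        = {⟨p, f p⟩} := by
    ext ⟨q, a⟩
    simp only [Finset.mem_filter, Finset.mem_univ, true_and, Finset.mem_singleton]
    constructor
    · rintro ⟨rfl, rfl⟩; rfl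
    · intro h; cases h; exact ⟨rfl, rfl⟩
  simp only [KEdges, Finset.mem_filter, Finset.mem_univ, true_and]
  constructor
  · rintro ⟨-, h⟩
    have hex (p : Fin m) : ∃ a : Fin (nn p), e.filter (fun x => x.1 = p) = {⟨p, a⟩} := by
      obtain ⟨⟨q, a⟩, ha⟩ := Finset.card_eq_one.1 (h p)
      have hq : q = p := (Finset.mem_filter.1 (ha.symm ▸ Finset.mem_singleton_self (⟨q, a⟩ : Σ p, Fin (nn p)) :
        (⟨q, a⟩ : Σ p, Fin (nn p)) ∈ e.filter (fun x => x.1 = p))).2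
      subst hq
      exact ⟨a, ha⟩
    choose f hf using hex
    refine ⟨f, ?_⟩
    ext ⟨q, a⟩
    have hmem := Finset.ext_iff.1 (hf q) ⟨q, a⟩
    simp only [Finset.mem_filter, and_true, Finset.mem_singleton, Sigma.mk.injEq, heq_eq_eq,
      true_and] at hmem
    simp [hmem, eq_comm]
  · rintro ⟨f, rfl⟩
    refine ⟨?_, fun p => by rw [filter_eq, Finset.card_singleton]⟩
    rw [Finset.card_eq_sum_card_fiberwise (f := Sigma.fst) (t := Finset.univ) (by simp)]
    simp [filter_eq]

lemma card_KEdges_filter {m : ℕ} {nn : Fin m → ℕ} (i j : Σ p : Fin m, Fin (nn p)) :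
    ((KEdges m nn).filter (fun e => i ∈ e ∧ j ∈ e)).card =
      (Finset.univ.filter
        (fun f : ∀ p, Fin (nn p) => f i.1 = i.2 ∧ f j.1 = j.2)).card := by
  symm
  refine Finset.card_bij (fun f _ => Finset.univ.filter (fun x => f x.1 = x.2)) ?_ ?_ ?_
  · intro f hf
    simp only [Finset.mem_filter, Finset.mem_univ, true_and] at hf ⊢
    exact ⟨mem_KEdges_iff.2 ⟨f, rfl⟩, hf⟩
  · intro f _ g _ h
    funext p
    have := Finset.ext_iff.1 h ⟨p, f p⟩
    simp only [Finset.mem_filter, Finset.mem_univ, true_and, true_iff] at this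
    exact this.symm
  · intro e he
    obtain ⟨he, hi, hj⟩ := Finset.mem_filter.1 he
    obtain ⟨f, rfl⟩ := mem_KEdges_iff.1 he
    simp only [Finset.mem_filter, Finset.mem_univ, true_and] at hi hj
    exact ⟨f, by simp [hi, hj], rfl⟩

lemma card_KEdges_filter_of_fst_eq {m : ℕ} {nn : Fin m → ℕ} {i j : Σ p : Fin m, Fin (nn p)}
    (hij : i ≠ j) (h : i.1 = j.1) :
    ((KEdges m nn).filter (fun e => i ∈ e ∧ j ∈ e)).card = 0 := by
  rw [card_KEdges_filter, Finset.card_eq_zero, Finset.filter_eq_empty_iff]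
  obtain ⟨p, a⟩ := i
  obtain ⟨q, b⟩ := j
  obtain rfl : p = q := h
  rintro f - ⟨ha, hb⟩
  exact hij (Sigma.ext rfl (heq_of_eq (ha.symm.trans hb)))

lemma card_KEdges_filter_of_fst_ne {m : ℕ} {nn : Fin m → ℕ} {i j : Σ p : Fin m, Fin (nn p)}
    (h : i.1 ≠ j.1) :
    ((KEdges m nn).filter (fun e => i ∈ e ∧ j ∈ e)).card =
      ∏ k ∈ (Finset.univ.erase i.1).erase j.1, nn k := by
  rw [card_KEdges_filter]
  obtain ⟨p, a⟩ := i
  obtain ⟨q, b⟩ := j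
  change p ≠ q at h
  have hS : Finset.univ.filter (fun f : ∀ p, Fin (nn p) => f p = a ∧ f q = b) =
      Fintype.piFinset (Function.update (Function.update
        (fun k => (Finset.univ : Finset (Fin (nn k)))) p {a}) q {b}) := by
    ext f
    simp only [Finset.mem_filter, Finset.mem_univ, true_and, Fintype.mem_piFinset]
    constructor
    · rintro ⟨rfl, rfl⟩ k
      by_cases hq : k = q
      · subst hq; simp
      by_cases hp : k = p
      · subst hp; simp [hq]
      · simp [hq, hp]
    · intro hf
      have hp := hf p
      have hq := hf q
      simp [h] at hp hq
      exact ⟨hp, hq⟩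
  change (Finset.univ.filter (fun f : ∀ p, Fin (nn p) => f p = a ∧ f q = b)).card = _
  rw [hS, Fintype.card_piFinset, ← Finset.mul_prod_erase _ _ (Finset.mem_univ p),
    ← Finset.mul_prod_erase _ _ (Finset.mem_erase.2 ⟨h.symm, Finset.mem_univ q⟩)]
  simp only [Function.update_self, Finset.card_singleton, one_mul, ne_eq, h, not_false_eq_true,
    Function.update_of_ne]
  refine Finset.prod_congr rfl fun k hk => ?_
  simp only [Finset.mem_erase] at hk
  simp [hk.1, hk.2.1]

lemma KAdj_apply {m : ℕ} {nn : Fin m → ℕ} (i j : Σ p : Fin m, Fin (nn p)) :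
    KAdj m nn i j = if i.1 = j.1 then 0 else
      (∏ k ∈ (Finset.univ.erase i.1).erase j.1, (nn k : ℝ)) / ((m : ℝ) - 1) := by
  unfold KAdj
  split_ifs with h₁ h₂ h₂
  · rfl
  · exact absurd (congrArg Sigma.fst h₁) h₂
  · simp [card_KEdges_filter_of_fst_eq h₁ h₂]
  · rw [card_KEdges_filter_of_fst_ne h₂, Nat.cast_prod]

lemma Matrix.isRoot_charpoly_iff_exists_mulVec_eq {n K : Type*} [Fintype n] [DecidableEq n]
    [Field K] (A : Matrix n n K) (μ : K) :
    A.charpoly.IsRoot μ ↔ ∃ v, v ≠ 0 ∧ A.mulVec v = μ • v := by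
  rw [Polynomial.IsRoot, Matrix.eval_charpoly, ← Matrix.exists_mulVec_eq_zero_iff]
  simp [Matrix.sub_mulVec, sub_eq_zero, eq_comm]

/-- A nonzero real is an eigenvalue of `KAdj m nn` iff it is one of the quotient matrix of the
partition into parts. -/
lemma isRoot_charpoly_KAdj_iff {m : ℕ} {nn : Fin m → ℕ} (hnn : ∀ i, 1 ≤ nn i) {α : ℝ}
    (hα : α ≠ 0) :
    (KAdj m nn).charpoly.IsRoot α ↔ ∃ y : Fin m → ℝ, y ≠ 0 ∧ ∀ p,
      ∑ q, (if p = q then 0 else (∏ k ∈ Finset.univ.erase p, (nn k : ℝ)) / ((m : ℝ) - 1) * y q)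
        = α * y p := by
  have sum_const (y : Fin m → ℝ) (i : Σ p, Fin (nn p)) :
      ∑ j, KAdj m nn i j * y j.1 = ∑ q, (if i.1 = q then 0 else
        (∏ k ∈ Finset.univ.erase i.1, (nn k : ℝ)) / ((m : ℝ) - 1) * y q) := by
    rw [Fintype.sum_sigma]
    refine Finset.sum_congr rfl fun q _ => ?_
    simp only [KAdj_apply]
    split_ifs with h
    · simp
    · rw [Finset.sum_const, Finset.card_univ, Fintype.card_fin, nsmul_eq_mul,
        ← Finset.mul_prod_erase _ _ (Finset.mem_erase.2 ⟨Ne.symm h, Finset.mem_univ q⟩)]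
      ring
  rw [Matrix.isRoot_charpoly_iff_exists_mulVec_eq]
  constructor
  · rintro ⟨v, hv, h⟩
    have hv' (i) : ∑ j, KAdj m nn i j * v j = α * v i := congrFun h i
    let y : Fin m → ℝ := fun p => v ⟨p, ⟨0, hnn p⟩⟩
    have hy (i) : v i = y i.1 := by
      apply mul_left_cancel₀ hα
      rw [← hv', ← hv']
      simp only [KAdj_apply]
    simp only [hy, sum_const] at hv'
    refine ⟨y, fun h0 => hv (funext fun i => by simp [hy, h0]), fun p => hv' ⟨p, ⟨0, hnn p⟩⟩⟩
  · rintro ⟨y, hy, h⟩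
    refine ⟨fun i => y i.1, fun h0 => hy (funext fun p => congrFun h0 ⟨p, ⟨0, hnn p⟩⟩),
      funext fun i => ?_⟩
    exact (sum_const y i).trans (h i.1)

/-- for `α ≠ 0`, `α` is an eigenvalue of `K^m_{n_1,…,n_m}` iff
`r^(m-1)·α` is an eigenvalue of `K^m_{r n_1, …, r n_m}` (eigenvalues of a real
matrix being exactly the roots of its characteristic polynomial). -/
theorem stmt_6 (m : ℕ) (hm : 2 ≤ m) (nn : Fin m → ℕ) (hnn : ∀ i, 1 ≤ nn i)
    (r : ℕ) (hr : 1 ≤ r) (α : ℝ) (hα : α ≠ 0) :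
    (KAdj m nn).charpoly.IsRoot α ↔
      (KAdj m (fun i => r * nn i)).charpoly.IsRoot ((r : ℝ) ^ (m - 1) * α) := by
  have hr0 : (r : ℝ) ^ (m - 1) ≠ 0 := pow_ne_zero _ (Nat.cast_ne_zero.2 (by lia))
  rw [isRoot_charpoly_KAdj_iff hnn hα,
    isRoot_charpoly_KAdj_iff (fun i => Nat.mul_pos hr (hnn i)) (mul_ne_zero hr0 hα)]
  refine exists_congr fun y => and_congr_right fun _ => forall_congr' fun p => ?_
  have hprod : ∏ k ∈ Finset.univ.erase p, ((r * nn k : ℕ) : ℝ) =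
      (r : ℝ) ^ (m - 1) * ∏ k ∈ Finset.univ.erase p, (nn k : ℝ) := by
    simp [Finset.prod_mul_distrib, Finset.card_erase_of_mem]
  simp only [hprod, mul_div_assoc, mul_assoc]
  rw [← mul_right_inj' hr0, Finset.mul_sum]
  simp only [mul_ite, mul_zero]
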